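/- Let p ∈ ℝ^{d_p} and q ∈ ℝ^{d_q} be probability distributions with H(p) > 0, H(q) > 0, V(p) > 0 and V(q) > 0, and let s denote a sharp distribution. Let (t_n) be a moderate sequence and set ε_n = e^{−n t_n²}. For ε ≥ 0 define R_n^{ent,F}(ε) = (1/n)·sup{ m ∈ ℕ : there exists a probability distribution Q̃ with p^{⊗n} ⊗ s^{⊗m} ≺ Q̃ and 1 − F(q^{⊗m} ⊗ s^{⊗n}, Q̃) ≤ ε }. Set ν = (V(p)/H(p)) / (V(q)/H(q)). Then lim_{n→∞} ( R_n^{ent,F}(ε_n) − H(p)/H(q) ) / t_n = −(√(2 V(p)) / H(q)) · |1 − 1/√ν|. -/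

import Mathlib

open Finset Filter Real Topology

noncomputable section

/-- A probability distribution on a finite type: nonnegative entries summing to 1. -/
def IsProbDist {α : Type*} [Fintype α] (a : α → ℝ) : Prop :=
  (∀ i, 0 ≤ a i) ∧ ∑ i, a i = 1

/-- A sharp distribution: a single entry equal to 1, all others 0. -/
def IsSharp {α : Type*} [Fintype α] (a : α → ℝ) : Prop :=
  ∃ i, a i = 1 ∧ ∀ j, j ≠ i → a j = 0

/-- The uniform distribution: all entries equal to `1 / |α|`. -/
def IsUniform {α : Type*} [Fintype α] (a : α → ℝ) : Prop :=
  ∀ i, a i = 1 / (Fintype.card α : ℝ)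

/-- Tensor (Kronecker) product of two vectors. -/
def tensor {α β : Type*} (a : α → ℝ) (b : β → ℝ) : α × β → ℝ :=
  fun x => a x.1 * b x.2

/-- `n`-fold tensor power of a vector. -/
def tpow {α : Type*} (a : α → ℝ) (n : ℕ) : (Fin n → α) → ℝ :=
  fun f => ∏ j, a (f j)

/-- Shannon entropy (natural logarithm, with the convention `0 · ln 0 = 0`). -/
def shannonH {α : Type*} [Fintype α] (a : α → ℝ) : ℝ :=
  -∑ i, a i * Real.log (a i)

/-- Entropy variance `V(a) = ∑ i, a i (ln a i + H(a))²`. -/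
def entV {α : Type*} [Fintype α] (a : α → ℝ) : ℝ :=
  ∑ i, a i * (Real.log (a i) + shannonH a) ^ 2

/-- Relative entropy `D(a‖b)`. -/
def relD {α : Type*} [Fintype α] (a b : α → ℝ) : ℝ :=
  ∑ i, a i * Real.log (a i / b i)

/-- Relative entropy variance `V(a‖b)`. -/
def relV {α : Type*} [Fintype α] (a b : α → ℝ) : ℝ :=
  ∑ i, a i * (Real.log (a i / b i) - relD a b) ^ 2

/-- Total variation distance. -/
def tvd {α : Type*} [Fintype α] (a b : α → ℝ) : ℝ :=
  (1 / 2) * ∑ i, |a i - b i|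

/-- Fidelity `F(a,b) = (∑ i √(a i · b i))²`. -/
def fid {α : Type*} [Fintype α] (a b : α → ℝ) : ℝ :=
  (∑ i, Real.sqrt (a i * b i)) ^ 2

/-- The entries of `a` sorted in non-increasing order, as a vector on `Fin (card α)`. -/
def descSorted {α : Type*} [Fintype α] (a : α → ℝ) : Fin (Fintype.card α) → ℝ :=
  fun i =>
    a ((Fintype.equivFin α).symm
      (Tuple.sort (fun j => -a ((Fintype.equivFin α).symm j)) i))

/-- `headSum a K = ∑_{1 ≤ i ≤ K} a^↓_i` (1-based indices `i`, comparison `(i : ℝ) ≤ K`,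
equivalently `i ≤ ⌊K⌋`). -/
def headSum {α : Type*} [Fintype α] (a : α → ℝ) (K : ℝ) : ℝ :=
  ∑ i ∈ Finset.univ.filter (fun i : Fin (Fintype.card α) => ((i : ℕ) + 1 : ℝ) ≤ K),
    descSorted a i

/-- `tailSum a K = ∑_{i ≥ K} a^↓_i` (1-based indices `i`, comparison `K ≤ (i : ℝ)`,
equivalently `i ≥ ⌈K⌉`). -/
def tailSum {α : Type*} [Fintype α] (a : α → ℝ) (K : ℝ) : ℝ :=
  ∑ i ∈ Finset.univ.filter (fun i : Fin (Fintype.card α) => K ≤ ((i : ℕ) + 1 : ℝ)),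
    descSorted a i

/-- `a` majorises `b` (written `a ≻ b`): every partial sum of the non-increasingly sorted
`a` dominates the corresponding partial sum of sorted `b` (shorter vectors padded with zeros). -/
def Maj {α β : Type*} [Fintype α] [Fintype β] (a : α → ℝ) (b : β → ℝ) : Prop :=
  ∀ j : ℕ, headSum b (j : ℝ) ≤ headSum a (j : ℝ)

/-- `a ≻_ε b`: approximate majorisation (from above) with total variation error:
there is a probability distribution `b̃` with `a ≻ b̃` and `δ(b, b̃) ≤ ε`. -/
def ApproxMajTV {α β : Type*} [Fintype α] [Fintype β] (a : α → ℝ) (b : β → ℝ) (ε : ℝ) : Prop :=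
  ∃ bt : β → ℝ, IsProbDist bt ∧ Maj a bt ∧ tvd b bt ≤ ε

/-- `a ≺_ε b`: approximate majorisation (from below) with total variation error:
there is a probability distribution `b̃` with `a ≺ b̃` and `δ(b, b̃) ≤ ε`. -/
def ApproxSubMajTV {α β : Type*} [Fintype α] [Fintype β] (a : α → ℝ) (b : β → ℝ) (ε : ℝ) : Prop :=
  ∃ bt : β → ℝ, IsProbDist bt ∧ Maj bt a ∧ tvd b bt ≤ ε

/-- A moderate sequence: `t n → 0` and `√n · t n → +∞`. -/
def ModerateSeq (t : ℕ → ℝ) : Prop :=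
  Tendsto t atTop (𝓝 0) ∧ Tendsto (fun n : ℕ => Real.sqrt (n : ℝ) * t n) atTop atTop

/-- The uniform distribution on `Fin d`. -/
def unif (d : ℕ) : Fin d → ℝ := fun _ => 1 / (d : ℝ)

/-- The embedding map `Γ` associated with `γ_i = c_i / N`: for each `i` it produces
`c_i` entries equal to `a_i / c_i`. -/
def embed {d : ℕ} (c : Fin d → ℕ) (a : Fin d → ℝ) : (Σ i : Fin d, Fin (c i)) → ℝ :=
  fun x => a x.1 / (c x.1 : ℝ)

/-- Cut-and-pile modification of the sorted version of `a`, with cut at `K`: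
the first entry absorbs the total mass of entries at (1-based) positions `≥ K`,
entries at positions `1 < i < K` are unchanged, and entries at positions `≥ K` are set to 0. -/
def cutAndPile {α : Type*} [Fintype α] (a : α → ℝ) (K : ℝ) : Fin (Fintype.card α) → ℝ :=
  fun i =>
    if (i : ℕ) = 0 then descSorted a i + tailSum a K
    else if ((i : ℕ) + 1 : ℝ) < K then descSorted a i else 0

lemma headSum_natCast {α : Type*} [Fintype α] (a : α → ℝ) (k : ℕ) :
    headSum a (k : ℝ) = ∑ i with (i : Fin (Fintype.card α)).val < k, descSorted a i := by
  unfold headSum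
  congr 1
  ext i
  simp only [mem_filter, mem_univ, true_and]
  exact_mod_cast Nat.succ_le_iff

lemma descSorted_antitone {α : Type*} [Fintype α] (a : α → ℝ) : Antitone (descSorted a) := by
  intro i j hij
  have := Tuple.monotone_sort (fun j => -a ((Fintype.equivFin α).symm j)) hij
  simpa [descSorted] using this

/-- The enumeration of the index type underlying `descSorted`. -/
def sortEquiv {α : Type*} [Fintype α] (a : α → ℝ) : Fin (Fintype.card α) ≃ α :=
  (Tuple.sort (fun j => -a ((Fintype.equivFin α).symm j))).trans (Fintype.equivFin α).symm

lemma descSorted_eq {α : Type*} [Fintype α] (a : α → ℝ) (i : Fin (Fintype.card α)) :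
    descSorted a i = a (sortEquiv a i) := rfl

lemma exists_finset_headSum {α : Type*} [Fintype α] (a : α → ℝ) (k : ℕ) :
    ∃ B : Finset α, #B ≤ k ∧ headSum a (k : ℝ) = ∑ x ∈ B, a x := by
  refine ⟨(univ.filter fun i : Fin (Fintype.card α) => i.val < k).map (sortEquiv a).toEmbedding,
    ?_, ?_⟩
  · rw [card_map]
    calc _ = #((univ.filter fun i : Fin (Fintype.card α) => i.val < k).map Fin.valEmbedding) :=
          (card_map _).symm
      _ ≤ #(range k) := card_le_card (by intro x; simp; rintro i hi rfl; exact hi)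
      _ = k := card_range k
  · rw [headSum_natCast, sum_map]
    rfl

lemma sum_le_sum_initial_of_antitone {N : ℕ} {f : Fin N → ℝ} (hf : Antitone f)
    (h0 : ∀ i, 0 ≤ f i) (S : Finset (Fin N)) {k : ℕ} (hS : #S ≤ k) :
    ∑ i ∈ S, f i ≤ ∑ i with i.val < k, f i := by
  by_cases hk : N ≤ k
  · refine sum_le_sum_of_subset_of_nonneg (fun i _ => ?_) fun i _ _ => h0 i
    simpa using i.2.trans_le hk
  push Not at hk
  set c := f ⟨k, hk⟩ with hc
  have hcard : #(univ.filter fun i : Fin N => i.val < k) = k := by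
    have : (univ.filter fun i : Fin N => i.val < k) = Finset.Iio (⟨k, hk⟩ : Fin N) := by
      ext i; simp [Fin.lt_def]
    rw [this, Fin.card_Iio]
  have h1 : ∑ i ∈ S, (f i - c) ≤ ∑ i with i.val < k, (f i - c) := by
    calc ∑ i ∈ S, (f i - c) ≤ ∑ i ∈ S, max (f i - c) 0 := sum_le_sum fun i _ => le_max_left _ _
      _ ≤ ∑ i, max (f i - c) 0 :=
        sum_le_sum_of_subset_of_nonneg (subset_univ _) fun i _ _ => le_max_right _ _
      _ = ∑ i with i.val < k, (f i - c) := by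
        rw [sum_filter]
        refine sum_congr rfl fun i _ => ?_
        split_ifs with h
        · exact max_eq_left (sub_nonneg.2 (hf (Fin.le_def.2 h.le)))
        · exact max_eq_right (sub_nonpos.2 (hf (Fin.le_def.2 (not_lt.1 h))))
  rw [sum_sub_distrib, sum_sub_distrib, sum_const, sum_const, hcard, nsmul_eq_mul,
    nsmul_eq_mul] at h1
  have h2 : (#S : ℝ) * c ≤ k * c := mul_le_mul_of_nonneg_right (by exact_mod_cast hS) (h0 _)
  linarith

lemma sum_le_headSum {α : Type*} [Fintype α] {a : α → ℝ} (ha : ∀ x, 0 ≤ a x) (B : Finset α)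
    {k : ℕ} (hB : #B ≤ k) : ∑ x ∈ B, a x ≤ headSum a (k : ℝ) := by
  rw [headSum_natCast]
  have h := sum_le_sum_initial_of_antitone (descSorted_antitone a) (fun i => ha _)
    (B.map (sortEquiv a).symm.toEmbedding) (k := k) (by rwa [card_map])
  rw [sum_map] at h
  simpa [descSorted_eq] using h

/-- Lumping outcomes together increases the partial sums of the sorted vector. -/
lemma headSum_le_of_pushforward {α β : Type*} [Fintype α] [Fintype β] [DecidableEq β]
    {a : α → ℝ} {b : β → ℝ} (ha : ∀ x, 0 ≤ a x) (g : α → β)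
    (h : ∀ y, ∑ x with g x = y, a x = b y) (k : ℕ) :
    headSum a (k : ℝ) ≤ headSum b (k : ℝ) := by
  obtain ⟨B, hB, hs⟩ := exists_finset_headSum a k
  have hb : ∀ y, 0 ≤ b y := fun y => h y ▸ sum_nonneg fun x _ => ha x
  rw [hs]
  refine le_trans ?_ (sum_le_headSum hb (B.image g) (card_image_le.trans hB))
  rw [← sum_fiberwise_of_maps_to (g := g) (t := B.image g) fun x hx => mem_image_of_mem g hx]
  refine sum_le_sum fun y _ => ?_
  rw [← h y]
  exact sum_le_sum_of_subset_of_nonneg (filter_subset_filter _ (subset_univ _)) fun x _ _ => ha x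

lemma headSum_le_sum {α : Type*} [Fintype α] {a : α → ℝ} (ha : ∀ x, 0 ≤ a x) (k : ℕ) :
    headSum a (k : ℝ) ≤ ∑ x, a x := by
  obtain ⟨B, -, hs⟩ := exists_finset_headSum a k
  rw [hs]
  exact sum_le_sum_of_subset_of_nonneg (subset_univ _) fun x _ _ => ha x

lemma IsProbDist.tensor {α β : Type*} [Fintype α] [Fintype β] {a : α → ℝ} {b : β → ℝ}
    (ha : IsProbDist a) (hb : IsProbDist b) : IsProbDist (tensor a b) := by
  refine ⟨fun x => mul_nonneg (ha.1 _) (hb.1 _), ?_⟩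
  simp only [_root_.tensor, Fintype.sum_prod_type]
  simp [← mul_sum, ha.2, hb.2]

lemma IsProbDist.tpow {α : Type*} [Fintype α] [DecidableEq α] {a : α → ℝ} (ha : IsProbDist a)
    (n : ℕ) : IsProbDist (tpow a n) := by
  refine ⟨fun x => prod_nonneg fun _ _ => ha.1 _, ?_⟩
  simp only [_root_.tpow]
  rw [← Fintype.sum_pow, ha.2, one_pow]

lemma headSum_tensor_le {α β : Type*} [Fintype α] [Fintype β] [DecidableEq α] {a : α → ℝ}
    {b : β → ℝ} (ha : IsProbDist a) (hb : IsProbDist b) (k : ℕ) :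
    headSum (tensor a b) (k : ℝ) ≤ headSum a (k : ℝ) := by
  refine headSum_le_of_pushforward (ha.tensor hb).1 Prod.fst (fun y => ?_) k
  rw [sum_filter, Fintype.sum_prod_type, Fintype.sum_eq_single y (fun x hx => by simp [hx])]
  simp [tensor, ← mul_sum, hb.2]

lemma headSum_tpow_succ_le {α : Type*} [Fintype α] [DecidableEq α] {a : α → ℝ}
    (ha : IsProbDist a) (m k : ℕ) :
    headSum (tpow a (m + 1)) (k : ℝ) ≤ headSum (tpow a m) (k : ℝ) := by
  refine headSum_le_of_pushforward (ha.tpow _).1 (fun f => Fin.tail f) (fun y => ?_) k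
  rw [sum_filter, ← (Fin.consEquiv fun _ => α).sum_comp, Fintype.sum_prod_type]
  simp only [Fin.consEquiv, Equiv.coe_fn_mk, Fin.tail_cons]
  simp [tpow, Fin.prod_univ_succ, ← sum_mul, ha.2]

lemma headSum_tpow_antitone {α : Type*} [Fintype α] [DecidableEq α] {a : α → ℝ}
    (ha : IsProbDist a) (k : ℕ) : Antitone fun m => headSum (tpow a m) (k : ℝ) :=
  antitone_nat_of_succ_le fun m => headSum_tpow_succ_le ha m k

lemma IsSharp.tpow {α : Type*} {s : α → ℝ} [Fintype α] (hs : IsSharp s) (n : ℕ) :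
    IsSharp (tpow s n) := by
  obtain ⟨i, hi, h⟩ := hs
  refine ⟨fun _ => i, by simp [_root_.tpow, hi], fun f hf => ?_⟩
  obtain ⟨j, hj⟩ := Function.ne_iff.1 hf
  exact prod_eq_zero (mem_univ j) (h _ hj)

lemma headSum_le_tensor_sharp {α β : Type*} [Fintype α] [Fintype β] {a : α → ℝ} {b : β → ℝ}
    (ha : IsProbDist a) (hb : IsProbDist b) (hs : IsSharp b) (k : ℕ) :
    headSum a (k : ℝ) ≤ headSum (tensor a b) (k : ℝ) := by
  obtain ⟨B, hB, h⟩ := exists_finset_headSum a k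
  obtain ⟨z, hz, -⟩ := hs
  rw [h]
  refine le_trans (le_of_eq ?_) (sum_le_headSum (ha.tensor hb).1 (B ×ˢ {z}) (by simpa))
  simp [tensor, hz]

lemma fid_tensor_sharp {α β : Type*} [Fintype α] [Fintype β] (a c : α → ℝ) {b : β → ℝ}
    (hs : IsSharp b) : fid (tensor a b) (tensor c b) = fid a c := by
  obtain ⟨z, hz, h⟩ := hs
  unfold fid tensor
  rw [Fintype.sum_prod_type]
  congr 1
  refine sum_congr rfl fun x _ => ?_
  rw [Fintype.sum_eq_single z fun y hy => by simp [h y hy]]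
  simp [hz]

/-- The probability that the surprisal `-ln a` is at most `L`. -/
def surprisalCdf {α : Type*} [Fintype α] (a : α → ℝ) (L : ℝ) : ℝ :=
  ∑ i with Real.exp (-L) ≤ a i, a i

lemma card_filter_exp_neg_le {α : Type*} [Fintype α] {a : α → ℝ} (ha : IsProbDist a) (L : ℝ) :
    (#(univ.filter fun i => Real.exp (-L) ≤ a i) : ℝ) ≤ Real.exp L := by
  have h1 : #(univ.filter fun i => Real.exp (-L) ≤ a i) * Real.exp (-L) ≤ 1 := by
    rw [← ha.2, ← nsmul_eq_mul]
    refine (card_nsmul_le_sum _ _ _ fun i hi => (mem_filter.1 hi).2).trans ?_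
    exact sum_le_sum_of_subset_of_nonneg (subset_univ _) fun x _ _ => ha.1 x
  refine le_of_mul_le_mul_right ?_ (Real.exp_pos (-L))
  rwa [← Real.exp_add, add_neg_cancel, Real.exp_zero]

lemma surprisalCdf_le_headSum {α : Type*} [Fintype α] {a : α → ℝ} (ha : IsProbDist a) (L : ℝ) :
    surprisalCdf a L ≤ headSum a (⌊Real.exp L⌋₊ : ℝ) :=
  sum_le_headSum ha.1 _ (Nat.le_floor (card_filter_exp_neg_le ha L))

lemma surprisalCdf_mono {α : Type*} [Fintype α] {a : α → ℝ} (ha : IsProbDist a) :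
    Monotone (surprisalCdf a) := fun _ _ h =>
  sum_le_sum_of_subset_of_nonneg
    (monotone_filter_right _ fun _ _ hx => (Real.exp_le_exp.2 (neg_le_neg h)).trans hx)
    fun x _ _ => ha.1 x

lemma surprisalCdf_le_one {α : Type*} [Fintype α] {a : α → ℝ} (ha : IsProbDist a) (L : ℝ) :
    surprisalCdf a L ≤ 1 := by
  rw [← ha.2]
  exact sum_le_sum_of_subset_of_nonneg (subset_univ _) fun x _ _ => ha.1 x

lemma headSum_le_surprisalCdf {α : Type*} [Fintype α] {a : α → ℝ} (ha : IsProbDist a)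
    {k : ℕ} {L : ℝ} (hk : (k : ℝ) ≤ Real.exp L) (u : ℝ) :
    headSum a (k : ℝ) ≤ surprisalCdf a (L + u) + Real.exp (-u) := by
  obtain ⟨B, hB, h⟩ := exists_finset_headSum a k
  rw [h, ← sum_filter_add_sum_filter_not B fun i => Real.exp (-(L + u)) ≤ a i]
  refine add_le_add ?_ ?_
  · exact sum_le_sum_of_subset_of_nonneg (filter_subset_filter _ (subset_univ _))
      fun x _ _ => ha.1 x
  · have h1 : ∑ x ∈ B with ¬ Real.exp (-(L + u)) ≤ a x, a x ≤ #B • Real.exp (-(L + u)) :=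
      (sum_le_card_nsmul _ _ _ fun i hi => (not_le.1 (mem_filter.1 hi).2).le).trans
        (nsmul_le_nsmul_left (Real.exp_pos _).le (card_filter_le _ _))
    refine h1.trans ?_
    rw [nsmul_eq_mul, neg_add, Real.exp_add, ← mul_assoc]
    have h2 : (#B : ℝ) ≤ Real.exp L := le_trans (by exact_mod_cast hB) hk
    have h3 : (#B : ℝ) * Real.exp (-L) ≤ 1 := by
      rwa [Real.exp_neg, ← div_eq_mul_inv, div_le_one (Real.exp_pos _)]
    exact mul_le_of_le_one_left (Real.exp_pos _).le h3

lemma sum_sqrt_mul_le_binary {α : Type*} [Fintype α] {a b : α → ℝ} (ha : IsProbDist a)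
    (hb : IsProbDist b) (B : Finset α) :
    ∑ x, √(a x * b x) ≤ √((∑ x ∈ B, a x) * ∑ x ∈ B, b x) +
      √((1 - ∑ x ∈ B, a x) * (1 - ∑ x ∈ B, b x)) := by
  classical
  have key : ∀ S : Finset α, ∑ x ∈ S, √(a x * b x) ≤ √((∑ x ∈ S, a x) * ∑ x ∈ S, b x) := by
    intro S
    rw [Real.sqrt_mul (sum_nonneg fun x _ => ha.1 x)]
    simp only [Real.sqrt_mul (ha.1 _)]
    exact Real.sum_sqrt_mul_sqrt_le S ha.1 hb.1
  have hc : ∀ {c : α → ℝ}, IsProbDist c → 1 - ∑ x ∈ B, c x = ∑ x ∈ Bᶜ, c x := by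
    intro c hc
    rw [← hc.2, ← sum_add_sum_compl B]; ring
  rw [hc ha, hc hb, ← sum_add_sum_compl B]
  exact add_le_add (key B) (key Bᶜ)

lemma binary_fidelity_le {x y : ℝ} (hx : x ≤ 1) (hy : 0 ≤ y) (hxy : 16 * y ≤ x) :
    (√(x * y) + √((1 - x) * (1 - y))) ^ 2 ≤ 1 - x / 4 := by
  have hx0 : 0 ≤ x := by linarith
  have h1 : √(x * y) ≤ x / 4 := Real.sqrt_le_iff.2 ⟨by linarith, by nlinarith⟩
  have h2 : √((1 - x) * (1 - y)) ≤ 1 - x / 2 :=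
    Real.sqrt_le_iff.2 ⟨by linarith, by nlinarith [mul_nonneg (sub_nonneg.2 hx) hy]⟩
  have h3 : √(x * y) + √((1 - x) * (1 - y)) ≤ 1 - x / 4 := by linarith
  have h4 : 0 ≤ √(x * y) + √((1 - x) * (1 - y)) := by positivity
  nlinarith

lemma fid_le_of_headSum_le {α β : Type*} [Fintype α] [Fintype β] {P : β → ℝ} {Q T : α → ℝ}
    (hQ : IsProbDist Q) (hT : IsProbDist T) {k : ℕ}
    (hmaj : headSum P (k : ℝ) ≤ headSum T (k : ℝ))
    (h : 16 * headSum Q (k : ℝ) ≤ headSum P (k : ℝ)) :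
    fid Q T ≤ 1 - headSum P (k : ℝ) / 4 := by
  obtain ⟨B, hB, hs⟩ := exists_finset_headSum T k
  have hQB := sum_le_headSum hQ.1 B hB
  have h1 := binary_fidelity_le (x := ∑ x ∈ B, T x) (y := ∑ x ∈ B, Q x)
    (by rw [← hT.2]; exact sum_le_sum_of_subset_of_nonneg (subset_univ _) fun x _ _ => hT.1 x)
    (sum_nonneg fun x _ => hQ.1 x) (by linarith)
  have h2 := sum_sqrt_mul_le_binary hQ hT B
  rw [mul_comm, mul_comm (1 - _)] at h2
  have h3 := pow_le_pow_left₀ (sum_nonneg fun x _ => Real.sqrt_nonneg _) h2 2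
  unfold fid
  linarith

lemma fid_le_of_tail_le {α β : Type*} [Fintype α] [Fintype β] {P : β → ℝ} {Q T : α → ℝ}
    (hQ : IsProbDist Q) (hT : IsProbDist T) {k : ℕ}
    (hmaj : headSum P (k : ℝ) ≤ headSum T (k : ℝ))
    (h : 16 * (1 - headSum P (k : ℝ)) ≤ 1 - headSum Q (k : ℝ)) :
    fid Q T ≤ 1 - (1 - headSum Q (k : ℝ)) / 4 := by
  obtain ⟨B, hB, hs⟩ := exists_finset_headSum T k
  have hQB := sum_le_headSum hQ.1 B hB
  have hT1 : ∑ x ∈ B, T x ≤ 1 := by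
    rw [← hT.2]; exact sum_le_sum_of_subset_of_nonneg (subset_univ _) fun x _ _ => hT.1 x
  have hQ0 : 0 ≤ ∑ x ∈ B, Q x := sum_nonneg fun x _ => hQ.1 x
  have h1 := binary_fidelity_le (x := 1 - ∑ x ∈ B, Q x) (y := 1 - ∑ x ∈ B, T x)
    (by linarith) (by linarith) (by linarith)
  rw [sub_sub_cancel, sub_sub_cancel] at h1
  have h2 := sum_sqrt_mul_le_binary hQ hT B
  rw [add_comm] at h2
  have h3 := pow_le_pow_left₀ (sum_nonneg fun x _ => Real.sqrt_nonneg _) h2 2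
  unfold fid
  linarith

/-- If the Lorenz curve of `P` is dominated by that of `Q` except where it is at most `δ`, and
all but `δ` of the mass of `Q` has surprisal at most `L`, then truncating `Q` at `L` and piling
the removed mass onto its largest entry gives a distribution majorising `P`. -/
lemma exists_maj_of_surprisalCdf {α β : Type*} [Fintype α] [Fintype β] {P : β → ℝ} {Q : α → ℝ}
    (hP : IsProbDist P) (hQ : IsProbDist Q) {L δ : ℝ} (hδ0 : 0 ≤ δ) (hδ1 : δ < 1)
    (htail : 1 - surprisalCdf Q L ≤ δ)
    (hlow : ∀ k : ℕ, 1 ≤ k → Real.log k ≤ L →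
      headSum P (k : ℝ) ≤ δ ∨ headSum P (k : ℝ) ≤ surprisalCdf Q (Real.log k)) :
    ∃ T : α → ℝ, IsProbDist T ∧ Maj T P ∧ 1 - fid Q T ≤ 3 * δ := by
  classical
  set A := univ.filter fun i => Real.exp (-L) ≤ Q i with hA
  have hAQ : surprisalCdf Q L = ∑ i ∈ A, Q i := rfl
  have hA1 : ∑ i ∈ A, Q i ≤ 1 := hAQ ▸ surprisalCdf_le_one hQ L
  have hApos : 0 < ∑ i ∈ A, Q i := by linarith
  have hne : Nonempty α := by
    obtain ⟨i, -, -⟩ := exists_ne_zero_of_sum_ne_zero hApos.ne'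
    exact ⟨i⟩
  obtain ⟨x₀, hx₀⟩ := Finite.exists_max Q
  have hmem : ∀ {M i}, Real.exp (-M) ≤ Q i → Real.exp (-M) ≤ Q x₀ := fun h => h.trans (hx₀ _)
  have hx₀A : x₀ ∈ A := by
    obtain ⟨i, hi, -⟩ := exists_ne_zero_of_sum_ne_zero hApos.ne'
    exact mem_filter.2 ⟨mem_univ _, hmem (mem_filter.1 hi).2⟩
  set c := 1 - (1 - δ) * ∑ i ∈ A, Q i with hc
  have hc' : δ ≤ c := by nlinarith
  set T : α → ℝ := fun x => (if x ∈ A then (1 - δ) * Q x else 0) + if x = x₀ then c else 0 with hT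
  have hT0 : ∀ x, 0 ≤ T x := by
    intro x
    have := mul_nonneg (sub_nonneg.2 hδ1.le) (hQ.1 x)
    simp only [hT]
    split_ifs <;> linarith
  have hsumT : ∀ B : Finset α, x₀ ∈ B → ∑ x ∈ B, T x = (1 - δ) * (∑ x ∈ B with x ∈ A, Q x) + c := by
    intro B hB
    simp only [hT]
    rw [sum_add_distrib, sum_ite_eq' B x₀, if_pos hB, ← sum_filter, mul_sum]
  have hTA : ∑ x ∈ A, T x = 1 := by
    rw [hsumT A hx₀A, filter_mem_eq_inter, inter_self]; ring
  have hTprob : IsProbDist T := by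
    refine ⟨hT0, ?_⟩
    rw [hsumT univ (mem_univ _), filter_mem_eq_inter, univ_inter]; ring
  have hTB : ∀ B : Finset α, x₀ ∈ B → ∑ x ∈ B, Q x ≤ ∑ x ∈ B, T x := by
    intro B hB
    rw [hsumT B hB, filter_mem_eq_inter]
    have h1 := sum_inter_add_sum_sdiff B A Q
    have h2 := sum_inter_add_sum_sdiff A B Q
    rw [inter_comm] at h2
    have h3 : ∑ x ∈ B \ A, Q x ≤ 1 - ∑ i ∈ A, Q i := by
      rw [← hQ.2, ← sum_add_sum_compl A Q, add_sub_cancel_left]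
      exact sum_le_sum_of_subset_of_nonneg (fun x hx => by simp at hx ⊢; exact hx.2)
        fun x _ _ => hQ.1 x
    have h4 : 0 ≤ ∑ x ∈ A \ B, Q x := sum_nonneg fun x _ => hQ.1 x
    nlinarith
  refine ⟨T, hTprob, fun k => ?_, ?_⟩
  · rcases Nat.eq_zero_or_pos k with rfl | hk
    · rw [headSum_natCast, headSum_natCast]; simp
    have hk0 : (0 : ℝ) < k := by exact_mod_cast hk
    rcases le_or_gt (Real.log k) L with hkL | hkL
    · rcases hlow k hk hkL with h | h
      · refine h.trans (le_trans ?_ (sum_le_headSum hT0 {x₀} (by simp; omega)))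
        rw [hsumT _ (mem_singleton_self _)]
        have : 0 ≤ ∑ x ∈ {x₀} with x ∈ A, Q x := sum_nonneg fun x _ => hQ.1 x
        nlinarith
      · refine h.trans ?_
        by_cases hx : Real.exp (-Real.log k) ≤ Q x₀
        · have hcard : #(univ.filter fun i => Real.exp (-Real.log k) ≤ Q i) ≤ k := by
            have := card_filter_exp_neg_le hQ (Real.log k)
            rw [Real.exp_log hk0] at this
            exact_mod_cast this
          exact (hTB _ (mem_filter.2 ⟨mem_univ _, hx⟩)).trans (sum_le_headSum hT0 _ hcard)
        · have : surprisalCdf Q (Real.log k) = 0 := by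
            unfold surprisalCdf
            rw [filter_false_of_mem fun i _ hi => hx (hmem hi), sum_empty]
          rw [this]
          simpa using sum_le_headSum hT0 ∅ (k := k) (by simp)
    · have hcard : #A ≤ k := by
        have h1 := card_filter_exp_neg_le hQ L
        have h2 : Real.exp L ≤ k := by
          rw [← Real.exp_log hk0]; exact Real.exp_le_exp.2 hkL.le
        exact_mod_cast h1.trans h2
      calc headSum P (k : ℝ) ≤ 1 := hP.2 ▸ headSum_le_sum hP.1 k
        _ = ∑ x ∈ A, T x := hTA.symm
        _ ≤ _ := sum_le_headSum hT0 A hcard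
  · have h1 : √(1 - δ) * ∑ i ∈ A, Q i ≤ ∑ x, √(Q x * T x) := by
      rw [mul_sum]
      refine (sum_le_sum fun x hx => ?_).trans
        (sum_le_sum_of_subset_of_nonneg (subset_univ A) fun x _ _ => Real.sqrt_nonneg _)
      rw [← Real.sqrt_sq (hQ.1 x), ← Real.sqrt_mul (sub_nonneg.2 hδ1.le), Real.sqrt_sq (hQ.1 x)]
      refine Real.sqrt_le_sqrt ?_
      have : (1 - δ) * Q x ≤ T x := by
        simp only [hT, if_pos hx]
        split_ifs <;> linarith
      nlinarith [mul_le_mul_of_nonneg_left this (hQ.1 x)]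
    have h2 := pow_le_pow_left₀ (by positivity) h1 2
    rw [mul_pow, Real.sq_sqrt (sub_nonneg.2 hδ1.le)] at h2
    have h3 : (1 - δ) ^ 2 ≤ (∑ i ∈ A, Q i) ^ 2 :=
      pow_le_pow_left₀ (sub_nonneg.2 hδ1.le) (by linarith) 2
    have h4 := mul_le_mul_of_nonneg_left h3 (sub_nonneg.2 hδ1.le)
    unfold fid
    nlinarith [mul_nonneg hδ0 (sq_nonneg δ), sq_nonneg δ, mul_nonneg (sq_nonneg δ) (sub_nonneg.2 hδ1.le)]

/-- The scaled cumulant generating functions of `Y n` under the weights `w n`, at speed `a n`,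
converge to that of a Gaussian with mean `μ` and standard deviation `σ`. -/
structure GaussianCgfLimit {Ω : ℕ → Type*} [∀ n, Fintype (Ω n)] (w Y : ∀ n, Ω n → ℝ)
    (a : ℕ → ℝ) (μ σ : ℝ) : Prop where
  prob : ∀ n, IsProbDist (w n)
  speed : Tendsto a atTop atTop
  lim : ∀ l : ℝ, Tendsto (fun n => Real.log (∑ i, w n i * Real.exp (l * a n * Y n i)) / a n)
    atTop (𝓝 (l * μ + l ^ 2 * σ ^ 2 / 2))

namespace GaussianCgfLimit

variable {Ω : ℕ → Type*} [∀ n, Fintype (Ω n)] {w Y : ∀ n, Ω n → ℝ} {a : ℕ → ℝ} {μ σ : ℝ}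

lemma neg (h : GaussianCgfLimit w Y a μ σ) : GaussianCgfLimit w (fun n i => -Y n i) a (-μ) σ := by
  refine ⟨h.prob, h.speed, fun l => ?_⟩
  have := h.lim (-l)
  simpa using this

lemma mgf_pos (h : GaussianCgfLimit w Y a μ σ) (l : ℝ) (n : ℕ) :
    0 < ∑ i, w n i * Real.exp (l * a n * Y n i) := by
  obtain ⟨i, hi, hne⟩ := exists_ne_zero_of_sum_ne_zero
    (show ∑ i, w n i ≠ 0 by rw [(h.prob n).2]; exact one_ne_zero)
  exact sum_pos' (fun j _ => mul_nonneg ((h.prob n).1 j) (Real.exp_pos _).le)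
    ⟨i, hi, mul_pos (lt_of_le_of_ne ((h.prob n).1 i) hne.symm) (Real.exp_pos _)⟩

lemma mgf_le (h : GaussianCgfLimit w Y a μ σ) {l c : ℝ} (hc : l * μ + l ^ 2 * σ ^ 2 / 2 < c) :
    ∀ᶠ n in atTop, ∑ i, w n i * Real.exp (l * a n * Y n i) ≤ Real.exp (a n * c) := by
  filter_upwards [(h.lim l).eventually (gt_mem_nhds hc), h.speed.eventually_gt_atTop 0] with n h1 h2
  rw [← Real.log_le_iff_le_exp (h.mgf_pos l n)]
  rw [div_lt_iff₀ h2] at h1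
  linarith

lemma le_mgf (h : GaussianCgfLimit w Y a μ σ) {l c : ℝ} (hc : c < l * μ + l ^ 2 * σ ^ 2 / 2) :
    ∀ᶠ n in atTop, Real.exp (a n * c) ≤ ∑ i, w n i * Real.exp (l * a n * Y n i) := by
  filter_upwards [(h.lim l).eventually (lt_mem_nhds hc), h.speed.eventually_gt_atTop 0] with n h1 h2
  rw [← Real.le_log_iff_exp_le (h.mgf_pos l n)]
  rw [lt_div_iff₀ h2] at h1
  linarith

/-- Chernoff upper bound. -/
lemma sum_ge_le (h : GaussianCgfLimit w Y a μ σ) (hσ : 0 < σ) {ρ y : ℝ} (hρ : 0 < ρ)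
    (hy : μ + σ * ρ < y) :
    ∀ᶠ n in atTop, ∑ i with y ≤ Y n i, w n i ≤ Real.exp (-(a n * (ρ ^ 2 / 2))) := by
  have hl : 0 < ρ / σ := by positivity
  have hc : ρ / σ * μ + (ρ / σ) ^ 2 * σ ^ 2 / 2 < ρ / σ * y - ρ ^ 2 / 2 := by
    have h1 := mul_lt_mul_of_pos_left hy hl
    have h2 : ρ / σ * (μ + σ * ρ) = ρ / σ * μ + ρ ^ 2 := by field_simp
    have h3 : (ρ / σ) ^ 2 * σ ^ 2 = ρ ^ 2 := by field_simp
    linarith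
  filter_upwards [h.mgf_le hc, h.speed.eventually_gt_atTop 0] with n h1 h2
  have h3 : (∑ i with y ≤ Y n i, w n i) * Real.exp (ρ / σ * a n * y) ≤
      ∑ i, w n i * Real.exp (ρ / σ * a n * Y n i) := by
    rw [sum_mul]
    refine (sum_le_sum fun i hi => ?_).trans (sum_le_sum_of_subset_of_nonneg (subset_univ _)
      fun i _ _ => mul_nonneg ((h.prob n).1 i) (Real.exp_pos _).le)
    refine mul_le_mul_of_nonneg_left (Real.exp_le_exp.2 ?_) ((h.prob n).1 i)
    exact mul_le_mul_of_nonneg_left (mem_filter.1 hi).2 (by positivity)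
  refine le_of_mul_le_mul_right ((h3.trans h1).trans (le_of_eq ?_))
    (Real.exp_pos (ρ / σ * a n * y))
  rw [← Real.exp_add]
  ring_nf

/-- Exponential tilting lower bound. -/
lemma le_sum_gt (h : GaussianCgfLimit w Y a μ σ) (hσ : 0 < σ) {ρ y : ℝ} (hρ : 0 < ρ)
    (hy : y < μ + σ * ρ) :
    ∀ᶠ n in atTop, Real.exp (-(a n * (ρ ^ 2 / 2))) ≤ ∑ i with y < Y n i, w n i := by
  obtain ⟨l, hl1, hl2⟩ : ∃ l, max 0 ((y - μ) / σ ^ 2) < l ∧ l < ρ / σ := by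
    refine exists_between (max_lt (by positivity) ?_)
    rw [div_lt_div_iff₀ (by positivity) hσ]
    nlinarith
  have hl0 : 0 < l := (le_max_left _ _).trans_lt hl1
  have hly : y < μ + l * σ ^ 2 := by
    have := (le_max_right _ _).trans_lt hl1
    rw [div_lt_iff₀ (by positivity)] at this
    linarith
  have hlρ : l ^ 2 * σ ^ 2 / 2 < ρ ^ 2 / 2 := by
    rw [lt_div_iff₀ hσ] at hl2
    nlinarith [mul_pos hl0 hσ]
  obtain ⟨d, hd0, hd1, hd2⟩ : ∃ d, 0 < d ∧ d ≤ μ + l * σ ^ 2 - y ∧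
      l * d < ρ ^ 2 / 2 - l ^ 2 * σ ^ 2 / 2 := by
    refine ⟨min (μ + l * σ ^ 2 - y) ((ρ ^ 2 / 2 - l ^ 2 * σ ^ 2 / 2) / (2 * l)), lt_min ?_ ?_,
      min_le_left _ _, ?_⟩
    · linarith
    · exact div_pos (by linarith) (by linarith)
    · refine (mul_le_mul_of_nonneg_left (min_le_right _ _) hl0.le).trans_lt ?_
      have : l * ((ρ ^ 2 / 2 - l ^ 2 * σ ^ 2 / 2) / (2 * l)) =
        (ρ ^ 2 / 2 - l ^ 2 * σ ^ 2 / 2) / 2 := by field_simp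
      rw [this]; linarith
  set η := d / σ ^ 2 with hη
  have hη0 : 0 < η := by positivity
  have hησ : η * σ ^ 2 = d := by rw [hη]; field_simp
  set b := μ + l * σ ^ 2 + d with hb
  set C := l * μ + l ^ 2 * σ ^ 2 / 2 with hC
  obtain ⟨s', hs'0, hs'1⟩ : ∃ s', 0 < s' ∧ s' < min (η * d / 4)
      (ρ ^ 2 / 2 - l ^ 2 * σ ^ 2 / 2 - l * d) :=
    exists_between (lt_min (by positivity) (by linarith))
  have hs1 := hs'1.trans_le (min_le_left _ _)
  have hs2 := hs'1.trans_le (min_le_right _ _)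
  have hsq : η ^ 2 * σ ^ 2 = η * d := by rw [← hησ]; ring
  have e1 : (l + η) * μ + (l + η) ^ 2 * σ ^ 2 / 2 < C - η * d / 4 + η * b := by
    have : (l + η) * μ + (l + η) ^ 2 * σ ^ 2 / 2 = C + η * μ + l * (η * σ ^ 2) + η ^ 2 * σ ^ 2 / 2 := by
      rw [hC]; ring
    rw [this, hησ, hsq, hb]
    have : η * (l * σ ^ 2) = l * d := by rw [← hησ]; ring
    nlinarith [mul_pos hη0 hd0]
  have e2 : (l - η) * μ + (l - η) ^ 2 * σ ^ 2 / 2 < C - η * d / 4 - η * y := by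
    have : (l - η) * μ + (l - η) ^ 2 * σ ^ 2 / 2 = C - η * μ - l * (η * σ ^ 2) + η ^ 2 * σ ^ 2 / 2 := by
      rw [hC]; ring
    rw [this, hησ, hsq]
    have h1 : η * (l * σ ^ 2) = l * d := by rw [← hησ]; ring
    have h2 := mul_le_mul_of_nonneg_left hd1 hη0.le
    nlinarith [mul_pos hη0 hd0]
  have hlim1 : Tendsto (fun n => a n * (η * d / 4 - s')) atTop atTop :=
    h.speed.atTop_mul_const (by linarith)
  have hlim2 : Tendsto (fun n => a n * (ρ ^ 2 / 2 - l ^ 2 * σ ^ 2 / 2 - l * d - s')) atTop atTop :=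
    h.speed.atTop_mul_const (by linarith)
  filter_upwards [h.mgf_le e1, h.mgf_le e2, h.le_mgf (show C - s' < C by linarith),
    h.speed.eventually_gt_atTop 0, hlim1.eventually_ge_atTop (Real.log 4),
    hlim2.eventually_ge_atTop (Real.log 2)] with n m1 m2 m3 ha h4 h2
  have key : ∑ i, w n i * Real.exp (l * a n * Y n i) ≤
      Real.exp (l * a n * b) * (∑ i with y < Y n i, w n i) +
      Real.exp (-(η * a n * b)) * (∑ i, w n i * Real.exp ((l + η) * a n * Y n i)) +
      Real.exp (η * a n * y) * ∑ i, w n i * Real.exp ((l - η) * a n * Y n i) := by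
    rw [sum_filter, mul_sum, mul_sum, mul_sum, ← sum_add_distrib, ← sum_add_distrib]
    refine sum_le_sum fun i _ => ?_
    have hw := (h.prob n).1 i
    have t1 : 0 ≤ Real.exp (l * a n * b) * (if y < Y n i then w n i else 0) := by
      split_ifs <;> positivity
    have t2 : 0 ≤ Real.exp (-(η * a n * b)) * (w n i * Real.exp ((l + η) * a n * Y n i)) := by
      positivity
    have t3 : 0 ≤ Real.exp (η * a n * y) * (w n i * Real.exp ((l - η) * a n * Y n i)) := by
      positivity
    have hηa : 0 < η * a n := by positivity
    rcases le_or_gt (Y n i) y with hY | hY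
    · refine le_trans ?_ (le_add_of_nonneg_left (add_nonneg t1 t2))
      rw [mul_left_comm, ← Real.exp_add]
      refine mul_le_mul_of_nonneg_left (Real.exp_le_exp.2 ?_) hw
      linarith [mul_le_mul_of_nonneg_left hY hηa.le]
    · rcases le_or_gt (Y n i) b with hYb | hYb
      · refine le_trans ?_ (le_add_of_nonneg_right t3)
        refine le_trans ?_ (le_add_of_nonneg_right t2)
        rw [if_pos hY, mul_comm]
        refine mul_le_mul_of_nonneg_right (Real.exp_le_exp.2 ?_) hw
        exact mul_le_mul_of_nonneg_left hYb (by positivity)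
      · refine le_trans ?_ (le_add_of_nonneg_right t3)
        refine le_trans ?_ (le_add_of_nonneg_left t1)
        rw [mul_left_comm, ← Real.exp_add]
        refine mul_le_mul_of_nonneg_left (Real.exp_le_exp.2 ?_) hw
        linarith [mul_le_mul_of_nonneg_left hYb.le hηa.le]
  have k1 : Real.exp (-(η * a n * b)) * (∑ i, w n i * Real.exp ((l + η) * a n * Y n i)) ≤
      Real.exp (a n * (C - η * d / 4)) := by
    refine (mul_le_mul_of_nonneg_left m1 (Real.exp_pos _).le).trans (le_of_eq ?_)
    rw [← Real.exp_add]; ring_nf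
  have k2 : Real.exp (η * a n * y) * ∑ i, w n i * Real.exp ((l - η) * a n * Y n i) ≤
      Real.exp (a n * (C - η * d / 4)) := by
    refine (mul_le_mul_of_nonneg_left m2 (Real.exp_pos _).le).trans (le_of_eq ?_)
    rw [← Real.exp_add]; ring_nf
  have k3 : 4 * Real.exp (a n * (C - η * d / 4)) ≤ Real.exp (a n * (C - s')) := by
    calc _ = Real.exp (Real.log 4 + a n * (C - η * d / 4)) := by
          rw [Real.exp_add, Real.exp_log (by norm_num)]
      _ ≤ _ := Real.exp_le_exp.2 (by linarith)
  have k4 : 2 * (Real.exp (l * a n * b) * Real.exp (-(a n * (ρ ^ 2 / 2)))) ≤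
      Real.exp (a n * (C - s')) := by
    calc _ = Real.exp (Real.log 2 + (l * a n * b + -(a n * (ρ ^ 2 / 2)))) := by
          rw [Real.exp_add, Real.exp_add, Real.exp_log (by norm_num)]
      _ ≤ _ := Real.exp_le_exp.2 (by
          have : l * a n * b = a n * (l * μ + l ^ 2 * σ ^ 2 + l * d) := by rw [hb]; ring
          rw [this, hC]
          linarith)
  refine le_of_mul_le_mul_left ?_ (Real.exp_pos (l * a n * b))
  linarith

end GaussianCgfLimit

lemma tendsto_log_sum_exp_sub_div_sq {ι : Type*} [Fintype ι] {w : ι → ℝ} (hw : IsProbDist w)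
    (c : ι → ℝ) (hc : ∑ i, w i * c i = 0) :
    Tendsto (fun θ : ℝ => (Real.log (∑ i, w i * Real.exp (θ * c i)) -
      θ ^ 2 * (∑ i, w i * c i ^ 2) / 2) / θ ^ 2) (𝓝 0) (𝓝 0) := by
  set V := ∑ i, w i * c i ^ 2 with hV
  set f : ℝ → ℝ := fun θ => ∑ i, w i * Real.exp (θ * c i) with hf
  have hf0 : f 0 = 1 := by simp [hf, hw.2]
  have hfc : Tendsto f (𝓝 0) (𝓝 1) := by
    have : Continuous f := by fun_prop
    exact hf0 ▸ this.tendsto 0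
  have hbig : (fun θ : ℝ => f θ - 1 - θ ^ 2 * V / 2) =O[𝓝 0] fun θ => θ ^ 3 := by
    have heq : (fun θ : ℝ => f θ - 1 - θ ^ 2 * V / 2) = fun θ => ∑ i, w i *
        (Real.exp (θ * c i) - ∑ j ∈ range 3, (θ * c i) ^ j / j.factorial) := by
      funext θ
      have : ∀ i, w i * (Real.exp (θ * c i) - ∑ j ∈ range 3, (θ * c i) ^ j / j.factorial) =
          w i * Real.exp (θ * c i) - w i - θ * (w i * c i) - θ ^ 2 / 2 * (w i * c i ^ 2) := by
        intro i
        simp only [sum_range_succ, range_zero, sum_empty, Nat.factorial]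
        push_cast
        ring
      rw [sum_congr rfl fun i _ => this i, sum_sub_distrib, sum_sub_distrib, sum_sub_distrib,
        ← mul_sum, ← mul_sum, hc, hw.2]
      ring
    rw [heq]
    apply Asymptotics.IsBigO.fun_sum
    intro i _
    refine Asymptotics.IsBigO.const_mul_left ?_ _
    have h1 : Tendsto (fun θ : ℝ => θ * c i) (𝓝 0) (𝓝 0) := by
      have : Continuous fun θ : ℝ => θ * c i := by fun_prop
      simpa using this.tendsto 0
    refine ((Real.exp_sub_sum_range_isBigO_pow 3).comp_tendsto h1).trans ?_
    refine Asymptotics.IsBigO.of_bound (|c i| ^ 3) (Eventually.of_forall fun θ => le_of_eq ?_)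
    simp only [Function.comp, norm_pow, norm_mul, Real.norm_eq_abs]
    ring
  have hlit : (fun θ : ℝ => f θ - 1 - θ ^ 2 * V / 2) =o[𝓝 0] fun θ => θ ^ 2 :=
    hbig.trans_isLittleO (Asymptotics.isLittleO_pow_pow (by norm_num))
  have hq : Tendsto (fun θ => (f θ - 1) / θ ^ 2) (𝓝[≠] 0) (𝓝 (V / 2)) := by
    have h1 := (hlit.tendsto_div_nhds_zero.mono_left nhdsWithin_le_nhds).add_const (V / 2)
      (f := fun θ : ℝ => (f θ - 1 - θ ^ 2 * V / 2) / θ ^ 2) (x := 𝓝[≠] 0)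
    rw [zero_add] at h1
    refine h1.congr' ?_
    filter_upwards [self_mem_nhdsWithin] with θ (hθ : θ ≠ 0)
    field_simp
    ring
  have hpos : ∀ᶠ θ in 𝓝[≠] (0 : ℝ), 0 < f θ :=
    (hfc.mono_left nhdsWithin_le_nhds).eventually (lt_mem_nhds one_pos)
  suffices h : Tendsto (fun θ : ℝ => (Real.log (f θ) - θ ^ 2 * V / 2) / θ ^ 2) (𝓝[≠] 0) (𝓝 0) by
    have h0 : (Real.log (f 0) - 0 ^ 2 * V / 2) / 0 ^ 2 = 0 := by simp
    have h1 := (continuousAt_iff_punctured_nhds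
      (f := fun θ : ℝ => (Real.log (f θ) - θ ^ 2 * V / 2) / θ ^ 2)).2 (by rwa [h0])
    rwa [ContinuousAt, h0] at h1
  have hup : Tendsto (fun θ => (f θ - 1) / θ ^ 2 - V / 2) (𝓝[≠] 0) (𝓝 0) := by
    simpa using hq.sub_const (V / 2)
  have hlo : Tendsto (fun θ => (f θ - 1) / θ ^ 2 / f θ - V / 2) (𝓝[≠] 0) (𝓝 0) := by
    simpa using (hq.div (hfc.mono_left nhdsWithin_le_nhds) one_ne_zero).sub_const (V / 2)
  refine tendsto_of_tendsto_of_tendsto_of_le_of_le' hlo hup ?_ ?_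
  · filter_upwards [hpos, self_mem_nhdsWithin] with θ hθ (hθ0 : θ ≠ 0)
    have h1 := Real.one_sub_inv_le_log_of_pos hθ
    have h2 : 0 < θ ^ 2 := by positivity
    rw [sub_div (Real.log _), mul_div_assoc, mul_div_cancel_left₀ _ h2.ne']
    refine sub_le_sub_right ?_ _
    rw [div_right_comm]
    refine div_le_div_of_nonneg_right ?_ h2.le
    rw [sub_div, div_self hθ.ne', one_div]
    exact h1
  · filter_upwards [hpos, self_mem_nhdsWithin] with θ hθ (hθ0 : θ ≠ 0)
    have h1 := Real.log_le_sub_one_of_pos hθ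
    have h2 : 0 < θ ^ 2 := by positivity
    rw [sub_div (Real.log _), mul_div_assoc, mul_div_cancel_left₀ _ h2.ne']
    exact sub_le_sub_right (div_le_div_of_nonneg_right h1 h2.le) _

lemma sum_tpow_mul_exp {α : Type*} [Fintype α] [DecidableEq α] (a : α → ℝ)
    (n : ℕ) (θ : ℝ) :
    ∑ f, tpow a n f * Real.exp (θ * -Real.log (tpow a n f)) =
      (∑ i, a i * Real.exp (θ * -Real.log (a i))) ^ n := by
  rw [Fintype.sum_pow]
  refine sum_congr rfl fun f _ => ?_
  unfold tpow
  by_cases h : ∃ j, a (f j) = 0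
  · obtain ⟨j, hj⟩ := h
    rw [prod_eq_zero (mem_univ j) hj, zero_mul, prod_eq_zero (mem_univ j) (by rw [hj, zero_mul])]
  · push Not at h
    rw [prod_mul_distrib, Real.log_prod fun j _ => h j, ← Real.exp_sum, ← sum_neg_distrib, mul_sum]

lemma ModerateSeq.eventually_pos {t : ℕ → ℝ} (ht : ModerateSeq t) : ∀ᶠ n in atTop, 0 < t n := by
  filter_upwards [ht.2.eventually_gt_atTop 0] with n hn
  exact pos_of_mul_pos_right hn (Real.sqrt_nonneg _)

lemma ModerateSeq.tendsto_speed {t : ℕ → ℝ} (ht : ModerateSeq t) :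
    Tendsto (fun n : ℕ => (n : ℝ) * t n ^ 2) atTop atTop := by
  have := ht.2.atTop_mul_atTop₀ ht.2
  refine this.congr fun n => ?_
  rw [mul_mul_mul_comm, Real.mul_self_sqrt n.cast_nonneg, sq]

lemma ModerateSeq.tendsto_scale {t : ℕ → ℝ} (ht : ModerateSeq t) :
    Tendsto (fun n : ℕ => (n : ℝ) * t n) atTop atTop := by
  have h1 : Tendsto (fun n : ℕ => √(n : ℝ)) atTop atTop :=
    Real.tendsto_sqrt_atTop.comp tendsto_natCast_atTop_atTop
  refine (h1.atTop_mul_atTop₀ ht.2).congr fun n => ?_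
  rw [← mul_assoc, Real.mul_self_sqrt n.cast_nonneg]

lemma gaussianCgfLimit_tpow {α : Type*} [Fintype α] [DecidableEq α] {a : α → ℝ}
    (ha : IsProbDist a) {t : ℕ → ℝ} (ht : ModerateSeq t) {m : ℕ → ℕ} {h c b σ : ℝ}
    (hm : Tendsto (fun n : ℕ => (m n : ℝ) / n) atTop (𝓝 c))
    (hb : Tendsto (fun n : ℕ => (m n * shannonH a - n * h) / (n * t n)) atTop (𝓝 b))
    (hσ : σ ^ 2 = c * entV a) :
    GaussianCgfLimit (Ω := fun n => Fin (m n) → α) (fun n => tpow a (m n))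
      (fun n f => (-Real.log (tpow a (m n) f) - n * h) / (n * t n))
      (fun n => (n : ℝ) * t n ^ 2) b σ := by
  refine ⟨fun n => ha.tpow _, ht.tendsto_speed, fun l => ?_⟩
  have hcent : ∑ i, a i * (-Real.log (a i) - shannonH a) = 0 := by
    simp only [mul_sub, sum_sub_distrib, ← sum_mul, ha.2, one_mul, mul_neg, sum_neg_distrib]
    simp [shannonH]
  have hV : ∑ i, a i * (-Real.log (a i) - shannonH a) ^ 2 = entV a := by
    unfold entV
    exact sum_congr rfl fun i _ => by ring
  have hlog := tendsto_log_sum_exp_sub_div_sq ha _ hcent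
  rw [hV] at hlog
  set f : ℝ → ℝ := fun θ => ∑ i, a i * Real.exp (θ * (-Real.log (a i) - shannonH a)) with hf
  have hlt : Tendsto (fun n => l * t n) atTop (𝓝 0) := by simpa using ht.1.const_mul l
  have hr := hlog.comp hlt
  have hlim : Tendsto (fun n : ℕ => (m n : ℝ) / n * (l ^ 2 * (entV a / 2 +
      (Real.log (f (l * t n)) - (l * t n) ^ 2 * entV a / 2) / (l * t n) ^ 2)) +
      l * ((m n * shannonH a - n * h) / (n * t n))) atTop (𝓝 (l * b + l ^ 2 * σ ^ 2 / 2)) := by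
    have := (hm.mul ((hr.const_add (entV a / 2)).const_mul (l ^ 2))).add (hb.const_mul l)
    refine this.trans_eq ?_
    rw [hσ]; ring_nf
  refine hlim.congr' ?_
  filter_upwards [ht.eventually_pos, eventually_gt_atTop 0] with n htn hn
  have hn' : (0 : ℝ) < n := by exact_mod_cast hn
  have hfpos : 0 < f (l * t n) := by
    obtain ⟨i, hi, hne⟩ := exists_ne_zero_of_sum_ne_zero
      (show ∑ i, a i ≠ 0 by rw [ha.2]; exact one_ne_zero)
    exact sum_pos' (fun j _ => mul_nonneg (ha.1 j) (Real.exp_pos _).le)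
      ⟨i, hi, mul_pos (lt_of_le_of_ne (ha.1 i) hne.symm) (Real.exp_pos _)⟩
  have hZ : ∑ x, tpow a (m n) x * Real.exp (l * (n * t n ^ 2) *
      ((-Real.log (tpow a (m n) x) - n * h) / (n * t n))) =
      f (l * t n) ^ m n * Real.exp (l * t n * (m n * shannonH a - n * h)) := by
    have h1 : f (l * t n) = (∑ i, a i * Real.exp (l * t n * -Real.log (a i))) *
        Real.exp (-(l * t n * shannonH a)) := by
      rw [sum_mul, hf]
      refine sum_congr rfl fun i _ => ?_
      rw [mul_assoc (a i), ← Real.exp_add]; ring_nf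
    rw [h1, mul_pow, ← sum_tpow_mul_exp, ← Real.exp_nat_mul, mul_assoc, ← Real.exp_add, sum_mul]
    refine sum_congr rfl fun x _ => ?_
    rw [mul_assoc (tpow a (m n) x), ← Real.exp_add]
    congr 2
    field_simp
    ring
  rw [hZ, Real.log_mul (pow_ne_zero _ hfpos.ne') (Real.exp_pos _).ne', Real.log_pow, Real.log_exp]
  rcases eq_or_ne l 0 with rfl | hl
  · have : f 0 = 1 := by simp [hf, ha.2]
    simp [this]
  · field_simp
    ring

section

variable {α : Type*} [Fintype α] {w : α → ℝ}

lemma surprisalCdf_eq_sum (hw : IsProbDist w) {L s : ℝ} (hs : 0 < s) (y : ℝ) :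
    surprisalCdf w (L + s * y) = ∑ i with (-Real.log (w i) - L) / s ≤ y, w i := by
  unfold surprisalCdf
  rw [sum_filter, sum_filter]
  refine sum_congr rfl fun i _ => ?_
  rcases (hw.1 i).eq_or_lt with h | h
  · simp [← h]
  · have : Real.exp (-(L + s * y)) ≤ w i ↔ (-Real.log (w i) - L) / s ≤ y := by
      rw [← Real.le_log_iff_exp_le h, div_le_iff₀ hs]
      constructor <;> intro <;> linarith
    simp only [this]

lemma one_sub_surprisalCdf_eq_sum (hw : IsProbDist w) {L s : ℝ} (hs : 0 < s) (y : ℝ) :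
    1 - surprisalCdf w (L + s * y) = ∑ i with y < (-Real.log (w i) - L) / s, w i := by
  rw [surprisalCdf_eq_sum hw hs, sub_eq_iff_eq_add', ← hw.2,
    ← sum_filter_add_sum_filter_not univ fun i => (-Real.log (w i) - L) / s ≤ y]
  simp only [not_le]

end

namespace GaussianCgfLimit

variable {Ω : ℕ → Type*} [∀ n, Fintype (Ω n)] {w : ∀ n, Ω n → ℝ} {a L s : ℕ → ℝ} {μ σ : ℝ}

lemma surprisalCdf_le
    (h : GaussianCgfLimit w (fun n i => (-Real.log (w n i) - L n) / s n) a μ σ)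
    (hs : ∀ᶠ n in atTop, 0 < s n) (hσ : 0 < σ) {ρ y : ℝ} (hρ : 0 < ρ) (hy : y < μ - σ * ρ) :
    ∀ᶠ n in atTop, surprisalCdf (w n) (L n + s n * y) ≤ Real.exp (-(a n * (ρ ^ 2 / 2))) := by
  filter_upwards [h.neg.sum_ge_le hσ hρ (y := -y) (by linarith), hs] with n h1 h2
  rw [surprisalCdf_eq_sum (h.prob n) h2]
  simpa only [neg_le_neg_iff] using h1

lemma le_surprisalCdf
    (h : GaussianCgfLimit w (fun n i => (-Real.log (w n i) - L n) / s n) a μ σ)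
    (hs : ∀ᶠ n in atTop, 0 < s n) (hσ : 0 < σ) {ρ y : ℝ} (hρ : 0 < ρ) (hy : μ - σ * ρ < y) :
    ∀ᶠ n in atTop, Real.exp (-(a n * (ρ ^ 2 / 2))) ≤ surprisalCdf (w n) (L n + s n * y) := by
  filter_upwards [h.neg.le_sum_gt hσ hρ (y := -y) (by linarith), hs] with n h1 h2
  rw [surprisalCdf_eq_sum (h.prob n) h2]
  simp only [neg_lt_neg_iff] at h1
  exact h1.trans (sum_le_sum_of_subset_of_nonneg
    (monotone_filter_right _ fun _ _ hx => le_of_lt hx) fun i _ _ => (h.prob n).1 i)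

lemma one_sub_surprisalCdf_le
    (h : GaussianCgfLimit w (fun n i => (-Real.log (w n i) - L n) / s n) a μ σ)
    (hs : ∀ᶠ n in atTop, 0 < s n) (hσ : 0 < σ) {ρ y : ℝ} (hρ : 0 < ρ) (hy : μ + σ * ρ < y) :
    ∀ᶠ n in atTop, 1 - surprisalCdf (w n) (L n + s n * y) ≤ Real.exp (-(a n * (ρ ^ 2 / 2))) := by
  filter_upwards [h.sum_ge_le hσ hρ hy, hs] with n h1 h2
  rw [one_sub_surprisalCdf_eq_sum (h.prob n) h2]
  exact (sum_le_sum_of_subset_of_nonneg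
    (monotone_filter_right _ fun _ _ hx => le_of_lt hx) fun i _ _ => (h.prob n).1 i).trans h1

lemma le_one_sub_surprisalCdf
    (h : GaussianCgfLimit w (fun n i => (-Real.log (w n i) - L n) / s n) a μ σ)
    (hs : ∀ᶠ n in atTop, 0 < s n) (hσ : 0 < σ) {ρ y : ℝ} (hρ : 0 < ρ) (hy : y < μ + σ * ρ) :
    ∀ᶠ n in atTop, Real.exp (-(a n * (ρ ^ 2 / 2))) ≤ 1 - surprisalCdf (w n) (L n + s n * y) := by
  filter_upwards [h.le_sum_gt hσ hρ hy, hs] with n h1 h2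
  rwa [one_sub_surprisalCdf_eq_sum (h.prob n) h2]

end GaussianCgfLimit

lemma eventually_mul_exp_neg_le {a : ℕ → ℝ} (ha : Tendsto a atTop atTop) {C : ℝ} (hC : 0 < C)
    {r r' : ℝ} (h : r' < r) :
    ∀ᶠ n in atTop, C * Real.exp (-(a n * r)) ≤ Real.exp (-(a n * r')) := by
  filter_upwards [(ha.atTop_mul_const (sub_pos.2 h)).eventually_ge_atTop (Real.log C)] with n hn
  calc _ = Real.exp (Real.log C + -(a n * r)) := by rw [Real.exp_add, Real.exp_log hC]
    _ ≤ _ := Real.exp_le_exp.2 (by linarith)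

lemma ModerateSeq.eventually_exp_neg_scale_le {t : ℕ → ℝ} (ht : ModerateSeq t) {δ : ℝ}
    (hδ : 0 < δ) (r : ℝ) :
    ∀ᶠ n : ℕ in atTop, Real.exp (-(n * t n * δ)) ≤ Real.exp (-(n * t n ^ 2 * r)) := by
  have h1 : Tendsto (fun n => t n * r) atTop (𝓝 0) := by simpa using ht.1.mul_const r
  filter_upwards [h1.eventually (gt_mem_nhds hδ), ht.tendsto_scale.eventually_ge_atTop 0]
    with n h2 h3
  refine Real.exp_le_exp.2 ?_
  nlinarith [mul_le_mul_of_nonneg_left h2.le h3]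

section

variable {Ω Ω' : ℕ → Type*} [∀ n, Fintype (Ω n)] [∀ n, Fintype (Ω' n)] {P : ∀ n, Ω n → ℝ}
  {Q : ∀ n, Ω' n → ℝ} {t L : ℕ → ℝ} {b σp σq : ℝ}

lemma eventually_headSum_separated (ht : ModerateSeq t) (hσp : 0 < σp) (hσq : 0 < σq)
    (hP : GaussianCgfLimit P (fun n i => (-Real.log (P n i) - L n) / (n * t n))
      (fun n => (n : ℝ) * t n ^ 2) 0 σp)
    (hQ : GaussianCgfLimit Q (fun n i => (-Real.log (Q n i) - L n) / (n * t n))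
      (fun n => (n : ℝ) * t n ^ 2) b σq)
    (hb : -√2 * |σp - σq| < b) :
    ∀ᶠ n : ℕ in atTop, ∃ k : ℕ,
      (16 * headSum (Q n) (k : ℝ) ≤ headSum (P n) (k : ℝ) ∧
        4 * Real.exp (-(n * t n ^ 2)) < headSum (P n) (k : ℝ)) ∨
      (16 * (1 - headSum (P n) (k : ℝ)) ≤ 1 - headSum (Q n) (k : ℝ) ∧
        4 * Real.exp (-(n * t n ^ 2)) < 1 - headSum (Q n) (k : ℝ)) := by
  have hs : ∀ᶠ n : ℕ in atTop, (0 : ℝ) < n * t n := ht.tendsto_scale.eventually_gt_atTop 0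
  have h2 : (0 : ℝ) < √2 := by positivity
  have hsq : √2 ^ 2 / 2 = 1 := by rw [Real.sq_sqrt (by norm_num)]; norm_num
  -- a rate strictly below `√2` that still leaves room in the hypothesis on `b`
  have hgap : 0 < b + √2 * |σp - σq| := by linarith
  obtain ⟨ρ, hρ1, hρ2⟩ : ∃ ρ, max (√2 / 2)
      (√2 - (b + √2 * |σp - σq|) / (2 * (σp + σq))) < ρ ∧ ρ < √2 :=
    exists_between (max_lt (by linarith) (sub_lt_self _ (by positivity)))
  have hρ0 : 0 < ρ := lt_trans (by positivity) ((le_max_left _ _).trans_lt hρ1)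
  have hρgap : (√2 - ρ) * (σp + σq) < b + √2 * |σp - σq| := by
    have := (le_max_right _ _).trans_lt hρ1
    have h3 : √2 - ρ < (b + √2 * |σp - σq|) / (2 * (σp + σq)) := by linarith
    rw [lt_div_iff₀ (by positivity)] at h3
    nlinarith [mul_pos (sub_pos.2 hρ2) (add_pos hσp hσq)]
  have hρsq : ρ ^ 2 / 2 < 1 := by
    rw [← hsq]; nlinarith
  have hg1 := mul_pos (sub_pos.2 hρ2) hσp
  have hg2 := mul_pos (sub_pos.2 hρ2) hσq
  have hE1 := eventually_mul_exp_neg_le ht.tendsto_speed (C := 33) (by norm_num) hρsq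
  rcases le_total σq σp with hle | hle
  · rw [abs_of_nonneg (sub_nonneg.2 hle)] at hρgap
    obtain ⟨y, hy1, hy2⟩ : ∃ y, 0 - σp * ρ < y ∧ y < b - σq * √2 :=
      exists_between (by nlinarith)
    obtain ⟨z, hz1, hz2⟩ := exists_between hy2
    have hδ : 0 < z - y := sub_pos.2 hz1
    filter_upwards [hP.le_surprisalCdf hs hσp hρ0 hy1, hQ.surprisalCdf_le hs hσq h2 hz2,
      ht.eventually_exp_neg_scale_le hδ 1, hE1] with n e1 e2 e3 e4
    refine ⟨⌊Real.exp (L n + n * t n * y)⌋₊, Or.inl ?_⟩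
    have f1 := surprisalCdf_le_headSum (hP.prob n) (L n + n * t n * y)
    have f2 := headSum_le_surprisalCdf (hQ.prob n)
      (Nat.floor_le (Real.exp_pos (L n + n * t n * y)).le) (n * t n * (z - y))
    rw [show L n + n * t n * y + n * t n * (z - y) = L n + n * t n * z by ring] at f2
    rw [hsq] at e2
    have := Real.exp_pos (-((n : ℝ) * t n ^ 2 * 1))
    rw [mul_one] at *
    constructor <;> linarith
  · rw [abs_of_nonpos (sub_nonpos.2 hle)] at hρgap
    obtain ⟨z, hz1, hz2⟩ : ∃ z, 0 + σp * √2 < z ∧ z < b + σq * ρ :=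
      exists_between (by nlinarith)
    obtain ⟨y, hy1, hy2⟩ := exists_between hz1
    have hδ : 0 < z - y := sub_pos.2 hy2
    filter_upwards [hP.one_sub_surprisalCdf_le hs hσp h2 hy1,
      hQ.le_one_sub_surprisalCdf hs hσq hρ0 hz2,
      ht.eventually_exp_neg_scale_le hδ 1, hE1] with n e1 e2 e3 e4
    refine ⟨⌊Real.exp (L n + n * t n * y)⌋₊, Or.inr ?_⟩
    have f1 := surprisalCdf_le_headSum (hP.prob n) (L n + n * t n * y)
    have f2 := headSum_le_surprisalCdf (hQ.prob n)
      (Nat.floor_le (Real.exp_pos (L n + n * t n * y)).le) (n * t n * (z - y))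
    rw [show L n + n * t n * y + n * t n * (z - y) = L n + n * t n * z by ring] at f2
    rw [hsq] at e1
    have := Real.exp_pos (-((n : ℝ) * t n ^ 2 * 1))
    rw [mul_one] at *
    constructor <;> linarith

lemma eventually_surprisalCdf_add_le (ht : ModerateSeq t) (hσp : 0 < σp) (hσq : 0 < σq)
    (hP : GaussianCgfLimit P (fun n i => (-Real.log (P n i) - L n) / (n * t n))
      (fun n => (n : ℝ) * t n ^ 2) 0 σp)
    (hQ : GaussianCgfLimit Q (fun n i => (-Real.log (Q n i) - L n) / (n * t n))
      (fun n => (n : ℝ) * t n ^ 2) b σq)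
    {ρ ρ' l r δ : ℝ} (hρ' : 0 < ρ') (hρ : ρ' < ρ) (hδ : 0 < δ)
    (h : (r < -(σp * ρ) ∧ b - σq * ρ' < l) ∨ (b + σq * ρ < l ∧ r < σp * ρ')) :
    ∀ᶠ n : ℕ in atTop, surprisalCdf (P n) (L n + n * t n * r) + Real.exp (-(n * t n * δ)) ≤
      surprisalCdf (Q n) (L n + n * t n * l) := by
  have hs : ∀ᶠ n : ℕ in atTop, (0 : ℝ) < n * t n := ht.tendsto_scale.eventually_gt_atTop 0
  have hE := eventually_mul_exp_neg_le ht.tendsto_speed (C := 2) (by norm_num)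
    (show ρ' ^ 2 / 2 < ρ ^ 2 / 2 by nlinarith)
  rcases h with ⟨h1, h2⟩ | ⟨h1, h2⟩
  · filter_upwards [hP.surprisalCdf_le hs hσp (hρ'.trans hρ) (y := r) (by linarith),
      hQ.le_surprisalCdf hs hσq hρ' h2, ht.eventually_exp_neg_scale_le hδ (ρ ^ 2 / 2), hE]
      with n e1 e2 e3 e4
    linarith
  · filter_upwards [hP.le_one_sub_surprisalCdf hs hσp hρ' (y := r) (by linarith),
      hQ.one_sub_surprisalCdf_le hs hσq (hρ'.trans hρ) h1,
      ht.eventually_exp_neg_scale_le hδ (ρ ^ 2 / 2), hE] with n e1 e2 e3 e4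
    linarith

/-- Between the extreme points `-κ σp` and `b + κ σq`, the Gaussian rate functions are separated:
either both left tails or both right tails are in the right order. -/
lemma exists_rates_separating (hσp : 0 < σp) (hσq : 0 < σq) {κ y : ℝ} (hκ : 0 < κ)
    (hb : b < -(κ * |σp - σq|)) (hy0 : -(κ * σp) ≤ y) (hy1 : y ≤ b + κ * σq) :
    ∃ ρ' ρ, 0 < ρ' ∧ ρ' < ρ ∧
      ((y < -(σp * ρ) ∧ b - σq * ρ' < y) ∨ (b + σq * ρ < y ∧ y < σp * ρ')) := by
  have hb0 : b < 0 := hb.trans_le (neg_nonpos.2 (by positivity))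
  have hab1 : κ * (σp - σq) < -b := by
    nlinarith [mul_le_mul_of_nonneg_left (le_abs_self (σp - σq)) hκ.le]
  have hab2 : κ * (σq - σp) < -b := by
    nlinarith [mul_le_mul_of_nonneg_left (neg_abs_le (σp - σq)) hκ.le]
  rcases le_or_gt y (b / 2) with hyb | hyb
  · have key : max 0 ((b - y) / σq) < -y / σp := by
      refine max_lt (div_pos (by linarith) hσp) ?_
      rw [div_lt_div_iff₀ hσq hσp]
      rcases le_total σq σp with h | h
      · nlinarith [mul_le_mul_of_nonneg_right hy0 (sub_nonneg.2 h)]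
      · nlinarith [mul_nonneg (show 0 ≤ -y by linarith) (sub_nonneg.2 h), mul_pos hσp (neg_pos.2 hb0)]
    obtain ⟨ρ', h1, h2⟩ := exists_between key
    obtain ⟨ρ, h3, h4⟩ := exists_between h2
    refine ⟨ρ', ρ, (le_max_left _ _).trans_lt h1, h3, Or.inl ⟨?_, ?_⟩⟩
    · rw [lt_div_iff₀ hσp] at h4; linarith
    · have := (le_max_right _ _).trans_lt h1
      rw [div_lt_iff₀ hσq] at this; linarith
  · have key : max 0 (y / σp) < (y - b) / σq := by
      refine max_lt (div_pos (by linarith) hσq) ?_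
      rw [div_lt_div_iff₀ hσp hσq]
      rcases le_total σp σq with h | h
      · nlinarith [mul_le_mul_of_nonneg_right hy1 (sub_nonneg.2 h)]
      · rcases le_total 0 y with hy | hy
        · nlinarith [mul_nonneg hy (sub_nonneg.2 h), mul_pos hσp (neg_pos.2 hb0)]
        · nlinarith [mul_nonneg (show 0 ≤ y - b / 2 by linarith) (sub_nonneg.2 h),
            mul_pos hσp (neg_pos.2 hb0), mul_pos hσq (neg_pos.2 hb0)]
    obtain ⟨ρ', h1, h2⟩ := exists_between key
    obtain ⟨ρ, h3, h4⟩ := exists_between h2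
    refine ⟨ρ', ρ, (le_max_left _ _).trans_lt h1, h3, Or.inr ⟨?_, ?_⟩⟩
    · rw [lt_div_iff₀ hσq] at h4; linarith
    · have := (le_max_right _ _).trans_lt h1
      rw [div_lt_iff₀ hσp] at this; linarith

lemma eventually_exists_maj (ht : ModerateSeq t) (hσp : 0 < σp) (hσq : 0 < σq)
    (hP : GaussianCgfLimit P (fun n i => (-Real.log (P n i) - L n) / (n * t n))
      (fun n => (n : ℝ) * t n ^ 2) 0 σp)
    (hQ : GaussianCgfLimit Q (fun n i => (-Real.log (Q n i) - L n) / (n * t n))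
      (fun n => (n : ℝ) * t n ^ 2) b σq)
    (hb : b < -√2 * |σp - σq|) :
    ∀ᶠ n : ℕ in atTop, ∃ T : Ω' n → ℝ, IsProbDist T ∧ Maj T (P n) ∧
      1 - fid (Q n) T ≤ Real.exp (-(n * t n ^ 2)) := by
  have hs : ∀ᶠ n : ℕ in atTop, (0 : ℝ) < n * t n := ht.tendsto_scale.eventually_gt_atTop 0
  have h2 : (0 : ℝ) < √2 := by positivity
  have hsq : √2 ^ 2 / 2 = 1 := by rw [Real.sq_sqrt (by norm_num)]; norm_num
  obtain ⟨κ, hκ2, hκb⟩ : ∃ κ, √2 < κ ∧ b < -(κ * |σp - σq|) := by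
    have hcont : Continuous fun κ : ℝ => -(κ * |σp - σq|) := by fun_prop
    have hev : ∀ᶠ κ in 𝓝[>] √2, b < -(κ * |σp - σq|) :=
      (hcont.tendsto √2).mono_left nhdsWithin_le_nhds |>.eventually
        (lt_mem_nhds (by linarith))
    obtain ⟨κ, h, h'⟩ := (hev.and self_mem_nhdsWithin).exists
    exact ⟨κ, h', h⟩
  have hκ0 : 0 < κ := h2.trans hκ2
  obtain ⟨ρ, hρ2, hρκ⟩ := exists_between hκ2
  have hρ0 : 0 < ρ := h2.trans hρ2
  have hρsq : 1 < ρ ^ 2 / 2 := by rw [← hsq]; nlinarith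
  obtain ⟨z, hz1, hz2⟩ : ∃ z, -(κ * σp) < z ∧ z < 0 - σp * ρ :=
    exists_between (by nlinarith)
  have hmid : ∀ᶠ n : ℕ in atTop, ∀ y ∈ Set.Icc (-(κ * σp)) (b + κ * σq), ∀ k : ℕ,
      (k : ℝ) ≤ Real.exp (L n + n * t n * y) →
      headSum (P n) (k : ℝ) ≤ surprisalCdf (Q n) (L n + n * t n * y) := by
    refine isCompact_Icc.induction_on (p := fun S => ∀ᶠ n : ℕ in atTop, ∀ y ∈ S, ∀ k : ℕ,
      (k : ℝ) ≤ Real.exp (L n + n * t n * y) →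
      headSum (P n) (k : ℝ) ≤ surprisalCdf (Q n) (L n + n * t n * y)) ?_ ?_ ?_ ?_
    · simp
    · exact fun S S' hSS h => h.mono fun n hn y hy => hn y (hSS hy)
    · intro S S' h h'
      filter_upwards [h, h'] with n hn hn' y hy
      exact hy.elim (hn y) (hn' y)
    · intro y hy
      obtain ⟨ρ', ρ, hρ', hρ, hor⟩ := exists_rates_separating hσp hσq hκ0 hκb hy.1 hy.2
      obtain ⟨lo, hi, hlo, hhi, hwin⟩ : ∃ lo hi, lo < y ∧ y < hi ∧ ∀ l r, lo < l → r < hi →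
          (r < -(σp * ρ) ∧ b - σq * ρ' < l) ∨ (b + σq * ρ < l ∧ r < σp * ρ') := by
        rcases hor with ⟨h1, h2⟩ | ⟨h1, h2⟩
        · exact ⟨_, _, h2, h1, fun l r hl hr => Or.inl ⟨hr, hl⟩⟩
        · exact ⟨_, _, h1, h2, fun l r hl hr => Or.inr ⟨hl, hr⟩⟩
      obtain ⟨l, hl1, hl2⟩ := exists_between hlo
      obtain ⟨r', hr1, hr2⟩ := exists_between hhi
      obtain ⟨r, hr3, hr4⟩ := exists_between hr2
      refine ⟨Set.Icc l r', mem_nhdsWithin_of_mem_nhds (Icc_mem_nhds hl2 hr1), ?_⟩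
      filter_upwards [eventually_surprisalCdf_add_le ht hσp hσq hP hQ hρ' hρ (sub_pos.2 hr3)
        (hwin l r hl1 hr4), hs] with n e1 e2 x hx k hk
      refine (headSum_le_surprisalCdf (hP.prob n) hk (n * t n * (r - r'))).trans ?_
      refine le_trans (add_le_add_left ?_ _) (e1.trans ?_)
      · exact surprisalCdf_mono (hP.prob n) (by nlinarith [hx.2])
      · exact surprisalCdf_mono (hQ.prob n) (by nlinarith [hx.1])
  filter_upwards [hmid, hs, hP.surprisalCdf_le hs hσp hρ0 hz2,
    hQ.one_sub_surprisalCdf_le hs hσq hρ0 (show b + σq * ρ < b + κ * σq by nlinarith),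
    ht.eventually_exp_neg_scale_le (sub_pos.2 hz1) (ρ ^ 2 / 2),
    eventually_mul_exp_neg_le ht.tendsto_speed (C := 6) (by norm_num) hρsq,
    ht.tendsto_speed.eventually_ge_atTop 0] with n e1 hsn e2 e3 e4 e5 e6
  have hε0 := Real.exp_pos (-((n : ℝ) * t n ^ 2 * (ρ ^ 2 / 2)))
  have hε1 : Real.exp (-((n : ℝ) * t n ^ 2)) ≤ 1 := Real.exp_le_one_iff.2 (by linarith)
  rw [mul_one] at e5
  have hmaj := exists_maj_of_surprisalCdf (hP.prob n) (hQ.prob n)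
    (L := L n + n * t n * (b + κ * σq)) (δ := Real.exp (-((n : ℝ) * t n ^ 2)) / 3)
    (by positivity) (by linarith) (by linarith) fun k hk hkL => ?_
  · simpa [mul_div_cancel₀] using hmaj
  have hk0 : (0 : ℝ) < k := by exact_mod_cast hk
  have hlog : Real.log k = L n + n * t n * ((Real.log k - L n) / (n * t n)) := by
    rw [mul_div_cancel₀ _ hsn.ne']; ring
  rcases le_or_gt (-(κ * σp)) ((Real.log k - L n) / (n * t n)) with h | h
  · right
    rw [hlog]
    refine e1 _ ⟨h, ?_⟩ k ?_
    · rw [div_le_iff₀ hsn]; linarith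
    · rw [← hlog, Real.exp_log hk0]
  · left
    have hk' : (k : ℝ) ≤ Real.exp (L n + n * t n * -(κ * σp)) := by
      rw [← Real.exp_log hk0]
      refine Real.exp_le_exp.2 ?_
      rw [div_lt_iff₀ hsn] at h
      linarith
    have := headSum_le_surprisalCdf (hP.prob n) hk' (n * t n * (z - -(κ * σp)))
    rw [show L n + n * t n * -(κ * σp) + n * t n * (z - -(κ * σp)) = L n + n * t n * z by ring]
      at this
    linarith

end

lemma ModerateSeq.tendsto_ceil_div {t : ℕ → ℝ} (ht : ModerateSeq t) {ρ : ℝ} (hρ : 0 < ρ) (c : ℝ) :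
    Tendsto (fun n : ℕ => (⌈n * (ρ + c * t n)⌉₊ - n * ρ) / (n * t n)) atTop (𝓝 c) := by
  have h0 : Tendsto (fun n => ρ + c * t n) atTop (𝓝 ρ) := by
    simpa using (ht.1.const_mul c).const_add ρ
  have hup : Tendsto (fun n : ℕ => c + ((n : ℝ) * t n)⁻¹) atTop (𝓝 c) := by
    simpa using ht.tendsto_scale.inv_tendsto_atTop.const_add c
  refine tendsto_of_tendsto_of_tendsto_of_le_of_le' tendsto_const_nhds hup ?_ ?_
  · filter_upwards [ht.tendsto_scale.eventually_gt_atTop 0] with n hn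
    rw [le_div_iff₀ hn]
    linarith [Nat.le_ceil ((n : ℝ) * (ρ + c * t n))]
  · filter_upwards [ht.tendsto_scale.eventually_gt_atTop 0, h0.eventually (lt_mem_nhds hρ)]
      with n hn hpos
    rw [div_le_iff₀ hn, add_mul, inv_mul_cancel₀ hn.ne']
    linarith [Nat.ceil_lt_add_one (mul_nonneg n.cast_nonneg hpos.le : (0 : ℝ) ≤ n * _)]

lemma ModerateSeq.tendsto_ceil_ratio {t : ℕ → ℝ} (ht : ModerateSeq t) {ρ : ℝ} (hρ : 0 < ρ) (c : ℝ) :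
    Tendsto (fun n : ℕ => (⌈n * (ρ + c * t n)⌉₊ : ℝ) / n) atTop (𝓝 ρ) := by
  have h := ((ht.tendsto_ceil_div hρ c).mul ht.1).const_add ρ
  rw [mul_zero, add_zero] at h
  refine h.congr' ?_
  filter_upwards [ht.eventually_pos, eventually_gt_atTop 0] with n hn hn0
  have : (0 : ℝ) < n := by exact_mod_cast hn0
  field_simp
  ring

section

variable {dp dq ds : ℕ} {p : Fin dp → ℝ} {q : Fin dq → ℝ} {s : Fin ds → ℝ} {t : ℕ → ℝ}

/-- The target sizes `m` that the entanglement-direction conversion of `p^{⊗n}` can reach with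
infidelity at most `e`. -/
def achievableSizes (p : Fin dp → ℝ) (q : Fin dq → ℝ) (s : Fin ds → ℝ) (n : ℕ) (e : ℝ) : Set ℕ :=
  {m : ℕ | ∃ Qt : (Fin m → Fin dq) × (Fin n → Fin ds) → ℝ,
    IsProbDist Qt ∧ Maj Qt (tensor (tpow p n) (tpow s m)) ∧
    1 - fid (tensor (tpow q m) (tpow s n)) Qt ≤ e}

lemma gaussianCgfLimit_tpow_self (hp : IsProbDist p) (hVp : 0 < entV p) (ht : ModerateSeq t) :
    GaussianCgfLimit (Ω := fun n => Fin n → Fin dp) (fun n => tpow p n)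
      (fun n f => (-Real.log (tpow p n f) - n * shannonH p) / (n * t n))
      (fun n => (n : ℝ) * t n ^ 2) 0 √(entV p) := by
  refine gaussianCgfLimit_tpow (m := fun n => n) (c := 1) hp ht ?_ (by simp) ?_
  · refine tendsto_const_nhds.congr' ?_
    filter_upwards [eventually_gt_atTop 0] with n hn
    rw [div_self (by positivity)]
  · rw [one_mul, Real.sq_sqrt hVp.le]

lemma gaussianCgfLimit_tpow_ceil (hq : IsProbDist q) (hHp : 0 < shannonH p) (hHq : 0 < shannonH q)
    (hVq : 0 < entV q) (ht : ModerateSeq t) (c : ℝ) :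
    GaussianCgfLimit
      (Ω := fun n : ℕ => Fin ⌈n * (shannonH p / shannonH q + c * t n)⌉₊ → Fin dq)
      (fun n => tpow q ⌈n * (shannonH p / shannonH q + c * t n)⌉₊)
      (fun n f => (-Real.log (tpow q ⌈n * (shannonH p / shannonH q + c * t n)⌉₊ f) -
        n * shannonH p) / (n * t n))
      (fun n => (n : ℝ) * t n ^ 2) (c * shannonH q) √(shannonH p / shannonH q * entV q) := by
  refine gaussianCgfLimit_tpow hq ht (ht.tendsto_ceil_ratio (div_pos hHp hHq) c) ?_
    (Real.sq_sqrt (by positivity))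
  refine ((ht.tendsto_ceil_div (div_pos hHp hHq) c).mul_const (shannonH q)).congr fun n => ?_
  rw [div_mul_eq_mul_div, sub_mul, mul_assoc (n : ℝ), div_mul_cancel₀ _ hHq.ne']

lemma eventually_mem_achievableSizes (hp : IsProbDist p) (hq : IsProbDist q) (hs : IsProbDist s)
    (hsharp : IsSharp s) (hHp : 0 < shannonH p) (hHq : 0 < shannonH q) (hVp : 0 < entV p)
    (hVq : 0 < entV q) (ht : ModerateSeq t) {c : ℝ}
    (hc : c * shannonH q < -√2 * |√(entV p) - √(shannonH p / shannonH q * entV q)|) :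
    ∀ᶠ n : ℕ in atTop, ⌈n * (shannonH p / shannonH q + c * t n)⌉₊ ∈
      achievableSizes p q s n (Real.exp (-(n * t n ^ 2))) := by
  filter_upwards [eventually_exists_maj ht (by positivity) (by positivity)
    (gaussianCgfLimit_tpow_self hp hVp ht) (gaussianCgfLimit_tpow_ceil hq hHp hHq hVq ht c) hc]
    with n ⟨T, hT, hmaj, hfid⟩
  refine ⟨tensor T (tpow s n), hT.tensor (hs.tpow n), fun k => ?_, ?_⟩
  · exact (headSum_tensor_le (hp.tpow n) (hs.tpow _) k).trans
      ((hmaj k).trans (headSum_le_tensor_sharp hT (hs.tpow n) (hsharp.tpow n) k))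
  · rwa [fid_tensor_sharp _ _ (hsharp.tpow n)]

lemma eventually_achievableSizes_lt (hp : IsProbDist p) (hq : IsProbDist q) (hs : IsProbDist s)
    (hsharp : IsSharp s) (hHp : 0 < shannonH p) (hHq : 0 < shannonH q) (hVp : 0 < entV p)
    (hVq : 0 < entV q) (ht : ModerateSeq t) {c : ℝ}
    (hc : -√2 * |√(entV p) - √(shannonH p / shannonH q * entV q)| < c * shannonH q) :
    ∀ᶠ n : ℕ in atTop, ∀ m ∈ achievableSizes p q s n (Real.exp (-(n * t n ^ 2))),
      m < ⌈n * (shannonH p / shannonH q + c * t n)⌉₊ := by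
  filter_upwards [eventually_headSum_separated ht (by positivity) (by positivity)
    (gaussianCgfLimit_tpow_self hp hVp ht) (gaussianCgfLimit_tpow_ceil hq hHp hHq hVq ht c) hc]
    with n ⟨k, hk⟩ m ⟨T, hT, hmaj, hfid⟩
  by_contra! hm
  have hP1 := headSum_tensor_le (hp.tpow n) (hs.tpow m) k
  have hP2 := headSum_le_tensor_sharp (hp.tpow n) (hs.tpow m) (hsharp.tpow m) k
  have hQ := (headSum_tensor_le (hq.tpow m) (hs.tpow n) k).trans (headSum_tpow_antitone hq k hm)
  dsimp only at hQ
  have hQp := (hq.tpow m).tensor (hs.tpow n)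
  rcases hk with ⟨h1, h2⟩ | ⟨h1, h2⟩
  · have := fid_le_of_headSum_le hQp hT (hmaj k) (by linarith)
    linarith
  · have := fid_le_of_tail_le hQp hT (hmaj k) (by linarith)
    linarith

end

lemma rate_constant_eq {Hp Hq Vp Vq : ℝ} (hHp : 0 < Hp) (hHq : 0 < Hq) (hVp : 0 < Vp)
    (hVq : 0 < Vq) :
    -(√(2 * Vp) / Hq) * |1 - 1 / √((Vp / Hp) / (Vq / Hq))| =
      -√2 * |√Vp - √(Hp / Hq * Vq)| / Hq := by
  have h1 : √(Hp / Hq * Vq) = √Vp * (1 / √((Vp / Hp) / (Vq / Hq))) := by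
    rw [one_div, ← Real.sqrt_inv, ← Real.sqrt_mul hVp.le]
    congr 1
    field_simp
  have h2 : √Vp - √Vp * (1 / √((Vp / Hp) / (Vq / Hq))) =
      √Vp * (1 - 1 / √((Vp / Hp) / (Vq / Hq))) := by ring
  rw [h1, h2, abs_mul, abs_of_nonneg (Real.sqrt_nonneg Vp), Real.sqrt_mul (by norm_num)]
  ring

/-- Moderate deviation expansion of the optimal entanglement-direction conversion rate
(infidelity error, vanishing error `ε_n = e^{-n t_n²}`). -/
theorem entanglement_direction_moderate_deviation_fidelity
    {dp dq ds : ℕ} (p : Fin dp → ℝ) (q : Fin dq → ℝ) (s : Fin ds → ℝ)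
    (hp : IsProbDist p) (hq : IsProbDist q)
    (hs : IsProbDist s) (hsharp : IsSharp s)
    (hHp : 0 < shannonH p) (hHq : 0 < shannonH q)
    (hVp : 0 < entV p) (hVq : 0 < entV q)
    (t : ℕ → ℝ) (ht : ModerateSeq t)
    (ε : ℕ → ℝ) (hε : ∀ n : ℕ, ε n = Real.exp (-((n : ℝ) * t n ^ 2)))
    (R : ℕ → ℝ → ℝ)
    (hR : ∀ n : ℕ, ∀ e : ℝ, 0 ≤ e → R n e =
      (↑(sSup {m : ℕ | ∃ Qt : (Fin m → Fin dq) × (Fin n → Fin ds) → ℝ,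
          IsProbDist Qt ∧ Maj Qt (tensor (tpow p n) (tpow s m)) ∧
          1 - fid (tensor (tpow q m) (tpow s n)) Qt ≤ e}) : ℝ) / (n : ℝ))
    (ν : ℝ) (hν : ν = (entV p / shannonH p) / (entV q / shannonH q)) :
    Tendsto (fun n : ℕ => (R n (ε n) - shannonH p / shannonH q) / t n) atTop
      (𝓝 (-(Real.sqrt (2 * entV p) / shannonH q) * |1 - 1 / Real.sqrt ν|)) := by
  rw [hν, rate_constant_eq hHp hHq hVp hVq]
  set ρ := shannonH p / shannonH q with hρ
  set b := -√2 * |√(entV p) - √(ρ * entV q)| with hb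
  have hRn : ∀ n, R n (ε n) =
      (sSup (achievableSizes p q s n (Real.exp (-(n * t n ^ 2)))) : ℕ) / (n : ℝ) := by
    intro n
    rw [hε n]
    exact hR n _ (Real.exp_nonneg _)
  have hlt : ∀ c, b / shannonH q < c → ∀ᶠ n : ℕ in atTop,
      ∀ m ∈ achievableSizes p q s n (Real.exp (-(n * t n ^ 2))), m < ⌈n * (ρ + c * t n)⌉₊ :=
    fun c hc => eventually_achievableSizes_lt hp hq hs hsharp hHp hHq hVp hVq ht
      ((div_lt_iff₀ hHq).1 hc)
  refine tendsto_order.2 ⟨fun a ha => ?_, fun a ha => ?_⟩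
  · obtain ⟨c, hac, hcb⟩ := exists_between ha
    filter_upwards [ht.eventually_pos, eventually_gt_atTop 0, hlt _ (lt_add_one _),
      eventually_mem_achievableSizes hp hq hs hsharp hHp hHq hVp hVq ht ((lt_div_iff₀ hHq).1 hcb)]
      with n htn hn hbdd hmem
    have hn' : (0 : ℝ) < n := by exact_mod_cast hn
    have hsup : (⌈n * (ρ + c * t n)⌉₊ : ℝ) ≤
        (sSup (achievableSizes p q s n (Real.exp (-(n * t n ^ 2)))) : ℕ) := by
      exact_mod_cast le_csSup ⟨_, fun m hm => (hbdd m hm).le⟩ hmem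
    rw [hRn, lt_div_iff₀ htn, lt_sub_iff_add_lt, lt_div_iff₀ hn']
    nlinarith [Nat.le_ceil ((n : ℝ) * (ρ + c * t n)), mul_lt_mul_of_pos_right hac (mul_pos hn' htn)]
  · obtain ⟨c, hbc, hca⟩ := exists_between ha
    have h0 : Tendsto (fun n => ρ + c * t n) atTop (𝓝 ρ) := by
      simpa using (ht.1.const_mul c).const_add ρ
    filter_upwards [ht.eventually_pos, eventually_gt_atTop 0, hlt c hbc,
      h0.eventually (lt_mem_nhds (div_pos hHp hHq)),
      (ht.tendsto_scale.atTop_mul_const (sub_pos.2 hca)).eventually_gt_atTop 1]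
      with n htn hn hbdd hpos hbig
    have hn' : (0 : ℝ) < n := by exact_mod_cast hn
    have hsup : ((sSup (achievableSizes p q s n (Real.exp (-(n * t n ^ 2)))) : ℕ) : ℝ) ≤
        ⌈n * (ρ + c * t n)⌉₊ := by
      exact_mod_cast csSup_le' fun m hm => (hbdd m hm).le
    rw [hRn, div_lt_iff₀ htn, sub_lt_iff_lt_add, div_lt_iff₀ hn']
    have := Nat.ceil_lt_add_one (mul_nonneg hn'.le hpos.le)
    nlinarith
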